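/- arXiv:math/0006206 — 16 statements merged into one kernel-verified Lean document; each statement's English description precedes it below -/
import Mathlib

section
/- Let A be a unital associative ℂ-algebra, let q,h,h' ∈ ℂ, and let a,b,c,d ∈ A satisfy the Kupershmidt (q,h,h')-relations. Then for every κ ∈ ℂ the matrix R_κ satisfies the RTT relation with T = [[a,b],[c,d]], i.e. R_κ·T₁·T₂ = T₂·T₁·R_κ. -/
open Matrix
open scoped Kronecker

/-- Index set for `4×4` matrices, pairs `(i,j)` with `i,j ∈ {1,2}`,
ordered `(1,1),(1,2),(2,1),(2,2)`. -/
abbrev Idx : Type := Fin 2 × Fin 2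

/-- The lexicographic identification of `Idx` with `Fin 4`. -/
def idx (p : Idx) : Fin 4 :=
  ⟨2 * p.1.val + p.2.val, by have h1 := p.1.isLt; have h2 := p.2.isLt; omega⟩

/-- View a `4×4` matrix as a matrix indexed by pairs, in the order
`(1,1),(1,2),(2,1),(2,2)`. -/
def ofM4 {R : Type*} (M : Matrix (Fin 4) (Fin 4) R) : Matrix Idx Idx R :=
  Matrix.of fun p r => M (idx p) (idx r)

/-- The RTT relation `R T₁ T₂ = T₂ T₁ R` for a complex `4×4` matrix `R`
(viewed in the algebra `A` via `algebraMap`) and `T₁ = T ⊗ 1`, `T₂ = 1 ⊗ T`. -/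
def RTT {A : Type*} [Ring A] [Algebra ℂ A]
    (R : Matrix Idx Idx ℂ) (T : Matrix (Fin 2) (Fin 2) A) : Prop :=
  R.map (algebraMap ℂ A) * (T ⊗ₖ (1 : Matrix (Fin 2) (Fin 2) A))
      * ((1 : Matrix (Fin 2) (Fin 2) A) ⊗ₖ T)
    = ((1 : Matrix (Fin 2) (Fin 2) A) ⊗ₖ T)
      * (T ⊗ₖ (1 : Matrix (Fin 2) (Fin 2) A)) * R.map (algebraMap ℂ A)

/-- The Kupershmidt `R`-matrix `R_κ`. -/
def RK (q h h' κ : ℂ) : Matrix Idx Idx ℂ :=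
  ofM4 !![1, -h * κ, h * κ, 0;
          0, q * κ, 1 - q * κ, 0;
          0, 1 - κ, κ, 0;
          0, -h' * κ, h' * κ, 1]

/-- The Kupershmidt `(q,h,h')`-relations imply the RTT relation for `R_κ`, for every `κ`. -/
theorem kupershmidt_RTT (A : Type*) [Ring A] [Algebra ℂ A]
    (q h h' : ℂ) (a b c d : A)
    (r1 : c * a = a * c) (r2 : b * d = d * b)
    (r3 : c * b = q • (b * c) - h • (a * c) - h' • (d * b))
    (r4 : a * d = d * a + (q - 1) • (b * c) - h • (a * c) - h' • (d * b))
    (r5 : q • (b * a) = a * b + h • (a ^ 2) + h' • (b ^ 2) - h • (d * a - b * c))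
    (r6 : c * d = q • (d * c) - h • (c ^ 2) - h' • (d ^ 2) + h' • (d * a - b * c)) :
    ∀ κ : ℂ, RTT (RK q h h' κ) !![a, b; c, d] := by
  intro κ
  rw [sq, sq] at r5 r6
  have hdet : a * d - c * b = d * a - b * c := by
    rw [r3, r4]
    module
  have comm (z : ℂ) (x : A) : x * algebraMap ℂ A z = z • x := by
    rw [← Algebra.commutes, Algebra.smul_def]
  unfold RTT
  ext ⟨i, j⟩ ⟨k, l⟩
  fin_cases i <;> fin_cases j <;> fin_cases k <;> fin_cases l <;>
    simp [Matrix.mul_apply, Fintype.sum_prod_type, RK, ofM4, idx, -map_mul, -map_sub, -map_neg,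
      comm, ← Algebra.smul_def, Matrix.one_apply, add_mul, r1, r2]
  · linear_combination (norm := module) -κ • r5 - (h * κ) • hdet
  · linear_combination (norm := module) κ • r5
  · module
  · linear_combination (norm := module) (q * κ) • hdet + κ • r3
  · linear_combination (norm := module) -κ • r3
  · module
  · linear_combination (norm := module) κ • r3
  · linear_combination (norm := module) -κ • r4
  · linear_combination (norm := module) κ • r6 - (h' * κ) • hdet
  · linear_combination (norm := module) -κ • r6
end

section
/- Let q,h,h',κ ∈ ℂ satisfy κ²·(q + h·h') − κ·(q + 1) + 1 = 0. Then the matrix R_κ satisfies the quantum Yang–Baxter equation R₁₂R₁₃R₂₃ = R₂₃R₁₃R₁₂. -/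
open Matrix
open scoped Kronecker

/-- Index set for `8×8` matrices: triples `(i,j,k)`. -/
abbrev Idx3 : Type := Fin 2 × Fin 2 × Fin 2

/-- `R₁₂`, acting on the first two factors. -/
def R12 (R : Matrix Idx Idx ℂ) : Matrix Idx3 Idx3 ℂ :=
  Matrix.of fun p r => R (p.1, p.2.1) (r.1, r.2.1) * (if p.2.2 = r.2.2 then 1 else 0)

/-- `R₁₃`, acting on the first and third factors. -/
def R13 (R : Matrix Idx Idx ℂ) : Matrix Idx3 Idx3 ℂ :=
  Matrix.of fun p r => R (p.1, p.2.2) (r.1, r.2.2) * (if p.2.1 = r.2.1 then 1 else 0)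

/-- `R₂₃`, acting on the last two factors. -/
def R23 (R : Matrix Idx Idx ℂ) : Matrix Idx3 Idx3 ℂ :=
  Matrix.of fun p r => (if p.1 = r.1 then 1 else 0) * R p.2 r.2

set_option maxHeartbeats 4000000 in
/-- If `κ² (q + h h') − κ (q + 1) + 1 = 0` then `R_κ` satisfies the
quantum Yang–Baxter equation. -/
theorem kupershmidt_YangBaxter (q h h' κ : ℂ)
    (hκ : κ ^ 2 * (q + h * h') - κ * (q + 1) + 1 = 0) :
    R12 (RK q h h' κ) * R13 (RK q h h' κ) * R23 (RK q h h' κ)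
      = R23 (RK q h h' κ) * R13 (RK q h h' κ) * R12 (RK q h h' κ) := by
  ext ⟨a, b, c⟩ ⟨d, e, f⟩
  fin_cases a <;> fin_cases b <;> fin_cases c <;> fin_cases d <;> fin_cases e <;> fin_cases f <;>
    simp [Matrix.mul_apply, Fintype.sum_prod_type, R12, R13, R23, RK, ofM4, idx] <;>
    grind
end

section
/- Let q,h,h',η ∈ ℂ with η ≠ 0, η⁻¹·h + η·h' = q − 1 and η⁻¹·h ≠ η·h'. Set ζ = h'/(η⁻¹·h − η·h') and G = [[1,η],[ζ,1+ηζ]] (so det G = 1 and G⁻¹ = [[1+ηζ,−η],[−ζ,1]]). Then for every κ ∈ ℂ, (G⊗G)·R_κ·(G⁻¹⊗G⁻¹) = [[1,0,0,0],[0,u,1−u,0],[0,1−v,v,0],[0,0,0,1]], where u = κ·(1 + η⁻¹·h) and v = κ·(1 + η·h'). -/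
open Matrix
open scoped Kronecker

/-- The similarity transformation by `G ⊗ G` brings `R_κ` to the form
with parameters `u = κ(1 + η⁻¹h)`, `v = κ(1 + ηh')`. -/
theorem kupershmidt_similarity (q h h' η ζ : ℂ) (hη : η ≠ 0)
    (hc : η⁻¹ * h + η * h' = q - 1)
    (hne : η⁻¹ * h ≠ η * h')
    (hζ : ζ = h' / (η⁻¹ * h - η * h')) :
    ∀ κ : ℂ,
      ((!![1, η; ζ, 1 + η * ζ] : Matrix (Fin 2) (Fin 2) ℂ) ⊗ₖ !![1, η; ζ, 1 + η * ζ])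
          * RK q h h' κ
          * ((!![1 + η * ζ, -η; -ζ, 1] : Matrix (Fin 2) (Fin 2) ℂ) ⊗ₖ !![1 + η * ζ, -η; -ζ, 1])
        = ofM4 !![1, 0, 0, 0;
                  0, κ * (1 + η⁻¹ * h), 1 - κ * (1 + η⁻¹ * h), 0;
                  0, 1 - κ * (1 + η * h'), κ * (1 + η * h'), 0;
                  0, 0, 0, 1] := by
  obtain ⟨d, hd⟩ : ∃ d, d = η⁻¹ * h - η * h' := ⟨_, rfl⟩
  have hd0 : d ≠ 0 := hd ▸ sub_ne_zero.mpr hne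
  have hh' : h' = ζ * d := by
    rw [hζ, ← hd, div_mul_cancel₀ _ hd0]
  have ha : η⁻¹ * h = d * (1 + η * ζ) := by
    linear_combination -hd + η * hh'
  have hh : h = η * (d * (1 + η * ζ)) := by
    rw [← ha, mul_inv_cancel_left₀ hη]
  have hq : q = 1 + d * (1 + η * ζ) + η * (ζ * d) := by
    linear_combination -hc + ha + η * hh'
  intro κ
  rw [ha]
  clear ha hc hne hζ hd
  subst hh' hh hq
  ext ⟨i, j⟩ ⟨k, l⟩
  fin_cases i <;> fin_cases j <;> fin_cases k <;> fin_cases l <;>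
    simp [RK, ofM4, idx, Matrix.mul_apply, Fintype.sum_prod_type, Fin.sum_univ_two] <;> ring
end

section
/- Let q,h,h',η ∈ ℂ with η ≠ 0, η⁻¹·h + η·h' = q − 1, η⁻¹·h ≠ η·h', 1 + η⁻¹·h ≠ 0 and 1 + η·h' ≠ 0. Set ζ = h'/(η⁻¹·h − η·h') and G = [[1,η],[ζ,1+ηζ]]. Then for κ = (1 + η⁻¹·h)⁻¹ one has (G⊗G)·R_κ·(G⁻¹⊗G⁻¹) = [[1,0,0,0],[0,1,0,0],[0,1−t,t,0],[0,0,0,1]] with t = (1 + η·h')/(1 + η⁻¹·h), and for κ = (1 + η·h')⁻¹ one has (G⊗G)·R_κ·(G⁻¹⊗G⁻¹) = [[1,0,0,0],[0,s,1−s,0],[0,0,1,0],[0,0,0,1]] with s = (1 + η⁻¹·h)/(1 + η·h'). -/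
open Matrix
open scoped Kronecker

/-- For `h = ηa`, `q = 1 + a + ηh'` and `h' = ζ(a - ηh')`, conjugation by `G ⊗ G` brings `R_κ`
to six-vertex form, for every `κ`. -/
theorem kronecker_conj_RK (a h' η ζ κ : ℂ) (hζ : h' = ζ * (a - η * h')) :
    ((!![1, η; ζ, 1 + η * ζ] : Matrix (Fin 2) (Fin 2) ℂ) ⊗ₖ !![1, η; ζ, 1 + η * ζ])
          * RK (1 + a + η * h') (η * a) h' κ
          * ((!![1 + η * ζ, -η; -ζ, 1] : Matrix (Fin 2) (Fin 2) ℂ) ⊗ₖ !![1 + η * ζ, -η; -ζ, 1])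
        = ofM4 !![1, 0, 0, 0;
                  0, (1 + a) * κ, 1 - (1 + a) * κ, 0;
                  0, 1 - (1 + η * h') * κ, (1 + η * h') * κ, 0;
                  0, 0, 0, 1] := by
  ext ⟨i, j⟩ ⟨k, l⟩
  fin_cases i <;> fin_cases j <;> fin_cases k <;> fin_cases l <;>
    simp [Matrix.mul_apply, Fintype.sum_prod_type, Fin.sum_univ_two, RK, ofM4, idx] <;>
    first
      | ring1
      | linear_combination κ * hζ
      | linear_combination -κ * hζ

/-- For `κ = κ₁` the transformed matrix is lower triangular with parameter
`t = κ₁/κ₂`, and for `κ = κ₂` it is upper triangular with parameter `s = κ₂/κ₁`. -/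
theorem kupershmidt_similarity_roots (q h h' η ζ : ℂ) (hη : η ≠ 0)
    (hc : η⁻¹ * h + η * h' = q - 1)
    (hne : η⁻¹ * h ≠ η * h')
    (h1 : 1 + η⁻¹ * h ≠ 0) (h2 : 1 + η * h' ≠ 0)
    (hζ : ζ = h' / (η⁻¹ * h - η * h')) :
    ((!![1, η; ζ, 1 + η * ζ] : Matrix (Fin 2) (Fin 2) ℂ) ⊗ₖ !![1, η; ζ, 1 + η * ζ])
          * RK q h h' ((1 + η⁻¹ * h)⁻¹)
          * ((!![1 + η * ζ, -η; -ζ, 1] : Matrix (Fin 2) (Fin 2) ℂ) ⊗ₖ !![1 + η * ζ, -η; -ζ, 1])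
        = ofM4 !![1, 0, 0, 0;
                  0, 1, 0, 0;
                  0, 1 - (1 + η * h') / (1 + η⁻¹ * h), (1 + η * h') / (1 + η⁻¹ * h), 0;
                  0, 0, 0, 1] ∧
    ((!![1, η; ζ, 1 + η * ζ] : Matrix (Fin 2) (Fin 2) ℂ) ⊗ₖ !![1, η; ζ, 1 + η * ζ])
          * RK q h h' ((1 + η * h')⁻¹)
          * ((!![1 + η * ζ, -η; -ζ, 1] : Matrix (Fin 2) (Fin 2) ℂ) ⊗ₖ !![1 + η * ζ, -η; -ζ, 1])
        = ofM4 !![1, 0, 0, 0;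
                  0, (1 + η⁻¹ * h) / (1 + η * h'), 1 - (1 + η⁻¹ * h) / (1 + η * h'), 0;
                  0, 0, 1, 0;
                  0, 0, 0, 1] := by
  have hh : h = η * (η⁻¹ * h) := (mul_inv_cancel_left₀ hη h).symm
  generalize η⁻¹ * h = a at *
  subst hh
  obtain rfl : q = 1 + a + η * h' := by linear_combination -hc
  have hζ' : h' = ζ * (a - η * h') := by
    rw [hζ, div_mul_cancel₀ _ (sub_ne_zero.mpr hne)]
  constructor
  · rw [kronecker_conj_RK a h' η ζ _ hζ', mul_inv_cancel₀ h1, sub_self, div_eq_mul_inv]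
  · rw [kronecker_conj_RK a h' η ζ _ hζ', mul_inv_cancel₀ h2, sub_self, div_eq_mul_inv]
end

section
/- Let u,v ∈ ℂ with u ≠ 0, v ≠ 0, u ≠ v, and set q' = u/v. Let R' = [[1,0,0,0],[0,u,1−u,0],[0,1−v,v,0],[0,0,0,1]]. Let A be a unital associative ℂ-algebra and a',b',c',d' ∈ A. Then R' satisfies the RTT relation with T' = [[a',b'],[c',d']] if and only if the following relations hold: c'a' = a'c', b'd' = d'b', c'b' = q'·b'c', a'd' = d'a' + (q'−1)·b'c', q'·b'a' = a'b', c'd' = q'·d'c'. In particular the resulting relations depend only on the ratio q' = u/v. -/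
open Matrix
open scoped Kronecker

/-- The RTT relations for the transformed `R'`-matrix are exactly the standard
one-parameter `q'`-deformation relations, with `q' = u/v`. -/
theorem RTT_iff_q'_relations (u v : ℂ) (hu : u ≠ 0) (hv : v ≠ 0) (huv : u ≠ v)
    (A : Type*) [Ring A] [Algebra ℂ A] (a' b' c' d' : A) :
    RTT (ofM4 !![1, 0, 0, 0;
                 0, u, 1 - u, 0;
                 0, 1 - v, v, 0;
                 0, 0, 0, 1]) !![a', b'; c', d'] ↔
      (c' * a' = a' * c' ∧ b' * d' = d' * b' ∧ c' * b' = (u / v) • (b' * c') ∧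
        a' * d' = d' * a' + (u / v - 1) • (b' * c') ∧
        (u / v) • (b' * a') = a' * b' ∧ c' * d' = (u / v) • (d' * c')) := by
  simp [RTT, ofM4, idx, ← Matrix.ext_iff, Matrix.mul_apply, Fintype.sum_prod_type,
    Fin.forall_fin_two, Fin.sum_univ_two, Matrix.one_apply, Algebra.algebraMap_eq_smul_one,
    sub_smul, sub_mul, and_assoc]
  constructor
  · rintro ⟨h₁, h₂, h₃, h₄, h₅, h₆, h₇, h₈, h₉, h₁₀, h₁₁, h₁₂⟩
    refine ⟨?_, ?_, ?_, ?_, ?_, ?_⟩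
    · linear_combination (norm := (match_scalars <;> field_simp <;> ring)) (-u⁻¹) • h₃
    · linear_combination (norm := (match_scalars <;> field_simp <;> ring)) u⁻¹ • h₆
    · linear_combination (norm := (match_scalars <;> field_simp <;> ring)) v⁻¹ • h₈
    · linear_combination (norm := (match_scalars <;> field_simp <;> ring)) (-v⁻¹) • h₉
    · linear_combination (norm := (match_scalars <;> field_simp <;> ring)) (-v⁻¹) • h₁
    · linear_combination (norm := (match_scalars <;> field_simp <;> ring)) v⁻¹ • h₁₁
  · rintro ⟨k₁, k₂, k₃, k₄, k₅, k₆⟩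
    refine ⟨?_, ?_, ?_, ?_, ?_, ?_, ?_, ?_, ?_, ?_, ?_, ?_⟩
    · linear_combination (norm := (match_scalars <;> field_simp <;> ring)) (-v) • k₅
    · linear_combination (norm := (match_scalars <;> field_simp <;> ring)) v • k₅
    · linear_combination (norm := (match_scalars <;> field_simp <;> ring)) (-u) • k₁
    · linear_combination (norm := (match_scalars <;> field_simp <;> ring)) u • k₄ + (v - u) • k₃
    · linear_combination (norm := (match_scalars <;> field_simp <;> ring)) (-v) • k₃
    · linear_combination (norm := (match_scalars <;> field_simp <;> ring)) u • k₂
    · linear_combination (norm := (match_scalars <;> field_simp <;> ring)) v • k₁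
    · linear_combination (norm := (match_scalars <;> field_simp <;> ring)) v • k₃
    · linear_combination (norm := (match_scalars <;> field_simp <;> ring)) (-v) • k₄
    · linear_combination (norm := (match_scalars <;> field_simp <;> ring)) (-v) • k₂
    · linear_combination (norm := (match_scalars <;> field_simp <;> ring)) v • k₆
    · linear_combination (norm := (match_scalars <;> field_simp <;> ring)) (-v) • k₆
end

section
/- Let q,h,h',λ ∈ ℂ with h ≠ 0, h' ≠ 0, λ² = (q−1)² − 4·h·h', and set η = ((q−1) + λ)/(2h'). Assume η ≠ 0 and q + 1 + λ ≠ 0. Then (1 + η⁻¹·h)/(1 + η·h') = (q + 1 − λ)/(q + 1 + λ). Moreover, for h' = 0, h ≠ 0, q ≠ 1 and η = h/(q−1), one has (1 + η⁻¹·h)/(1 + η·h') = q; and for h = 0, h' ≠ 0, q ≠ 1 and η = (q−1)/h', one has (1 + η⁻¹·h)/(1 + η·h') = q⁻¹. -/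
/-- The effective deformation parameter `q' = (1 + η⁻¹h)/(1 + ηh')`:
generically it equals `(q+1−λ)/(q+1+λ)` with `λ² = (q−1)² − 4hh'`;
for `h' = 0` it equals `q`, and for `h = 0` it equals `q⁻¹`. -/
theorem kupershmidt_effective_parameter :
    (∀ q h h' lam η : ℂ, h ≠ 0 → h' ≠ 0 →
      lam ^ 2 = (q - 1) ^ 2 - 4 * h * h' →
      η = ((q - 1) + lam) / (2 * h') →
      η ≠ 0 → q + 1 + lam ≠ 0 →
      (1 + η⁻¹ * h) / (1 + η * h') = (q + 1 - lam) / (q + 1 + lam)) ∧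
    (∀ q h h' η : ℂ, h' = 0 → h ≠ 0 → q ≠ 1 → η = h / (q - 1) →
      (1 + η⁻¹ * h) / (1 + η * h') = q) ∧
    (∀ q h h' η : ℂ, h = 0 → h' ≠ 0 → q ≠ 1 → η = (q - 1) / h' →
      (1 + η⁻¹ * h) / (1 + η * h') = q⁻¹) := by
  refine ⟨?_, ?_, ?_⟩
  · intro q h h' lam η _ hh' hlam hη hη0 hden
    have h₁ : η * h' = (q - 1 + lam) / 2 := by
      rw [hη]
      field_simp
    have h₂ : η⁻¹ * h = (q - 1 - lam) / 2 := by
      rw [inv_mul_eq_iff_eq_mul₀ hη0]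
      apply mul_right_cancel₀ hh'
      linear_combination (-(q - 1 - lam) / 2) * h₁ + hlam / 4
    rw [h₁, h₂, show 1 + (q - 1 - lam) / 2 = (q + 1 - lam) / 2 by ring,
      show 1 + (q - 1 + lam) / 2 = (q + 1 + lam) / 2 by ring]
    exact div_div_div_cancel_right₀ two_ne_zero _ _
  · rintro q h _ _ rfl hh _ rfl
    rw [inv_div, div_mul_cancel₀ _ hh]
    simp
  · rintro q _ h' _ rfl hh' _ rfl
    rw [div_mul_cancel₀ _ hh']
    simp
end

section
/- Let q,h ∈ ℂ with q ≠ 1, set η = h/(q−1) and G = [[1,η],[0,1]]. Then (G⊗G)·R·(G⁻¹⊗G⁻¹) = [[1,0,0,0],[0,q,1−q,0],[0,0,1,0],[0,0,0,1]], where R = [[1,−h,h,0],[0,q,1−q,0],[0,0,1,0],[0,0,0,1]] is the hybrid (q,h) R-matrix of the Kupershmidt deformation with h' = 0. -/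
open Matrix
open scoped Kronecker

/-- The hybrid `(q,h)` `R`-matrix of the Kupershmidt deformation with `h' = 0`
is transformed by `G ⊗ G`, `G = [[1,η],[0,1]]`, `η = h/(q−1)`, to the standard
one-parameter `R`-matrix. -/
theorem kupershmidt_h'_zero_transforms (q h : ℂ) (hq : q ≠ 1) :
    ((!![1, h / (q - 1); 0, 1] : Matrix (Fin 2) (Fin 2) ℂ)
        ⊗ₖ !![1, h / (q - 1); 0, 1])
      * ofM4 !![1, -h, h, 0;
                0, q, 1 - q, 0;
                0, 0, 1, 0;
                0, 0, 0, 1]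
      * ((!![1, h / (q - 1); 0, 1] : Matrix (Fin 2) (Fin 2) ℂ)⁻¹
          ⊗ₖ (!![1, h / (q - 1); 0, 1] : Matrix (Fin 2) (Fin 2) ℂ)⁻¹)
      = ofM4 !![1, 0, 0, 0;
                0, q, 1 - q, 0;
                0, 0, 1, 0;
                0, 0, 0, 1] := by
  have hq' : q - 1 ≠ 0 := sub_ne_zero.mpr hq
  have hG : (!![1, h / (q - 1); 0, 1] : Matrix (Fin 2) (Fin 2) ℂ)⁻¹
      = !![1, -(h / (q - 1)); 0, 1] := by
    apply Matrix.inv_eq_right_inv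
    simp [Matrix.one_fin_two]
  obtain ⟨η, hη⟩ : ∃ η, η = h / (q - 1) := ⟨_, rfl⟩
  have hh : h = η * (q - 1) := by rw [hη, div_mul_cancel₀ h hq']
  rw [hG, ← hη, hh]
  ext ⟨i, j⟩ ⟨k, l⟩
  fin_cases i <;> fin_cases j <;> fin_cases k <;> fin_cases l <;>
    simp [Matrix.mul_apply, Fintype.sum_prod_type, ofM4, idx] <;> ring
end

section
/- Let q,h,x ∈ ℂ with q ≠ 1 and x ≠ 0, set y = h/(q−1) and M = [[x,y],[0,1]]. Then (M⁻¹⊗M⁻¹)·R_{q,h}·(M⊗M) = [[1,0,0,0],[0,q,1−q²,0],[0,0,q,0],[0,0,0,1]], where R_{q,h} = [[1,h,−qh,h²],[0,q,1−q²,qh],[0,0,q,−h],[0,0,0,1]] is the Ballesteros–Herranz–Parashar R-matrix. In particular the result is independent of x, and the parameter h can be transformed away. -/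
open Matrix
open scoped Kronecker

/-- `M ⊗ M` with `M = [[x, y],[0,1]]` intertwines the Ballesteros–Herranz–Parashar matrix
with parameter `h = y(q−1)` and the standard `R_q`; no invertibility is needed. -/
lemma kronecker_intertwines_BHP {K : Type*} [CommRing K] (q x y : K) :
    ofM4 !![1, y * (q - 1), -q * (y * (q - 1)), (y * (q - 1)) ^ 2;
            0, q, 1 - q ^ 2, q * (y * (q - 1));
            0, 0, q, -(y * (q - 1));
            0, 0, 0, 1]
      * (!![x, y; 0, 1] ⊗ₖ !![x, y; 0, 1])
      = (!![x, y; 0, 1] ⊗ₖ !![x, y; 0, 1])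
      * ofM4 !![1, 0, 0, 0;
                0, q, 1 - q ^ 2, 0;
                0, 0, q, 0;
                0, 0, 0, 1] := by
  ext ⟨i, j⟩ ⟨k, l⟩
  fin_cases i <;> fin_cases j <;> fin_cases k <;> fin_cases l <;>
    simp [Matrix.mul_apply, Fintype.sum_prod_type, ofM4, idx] <;> ring

/-- The Ballesteros–Herranz–Parashar `R_{q,h}` matrix is transformed to the
standard `R_q` by `M ⊗ M`, `M = [[x, h/(q−1)],[0,1]]`, independently of `x ≠ 0`:
the parameter `h` can be transformed away. -/
theorem BHP_transforms_to_Rq (q h x : ℂ) (hq : q ≠ 1) (hx : x ≠ 0) :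
    ((!![x, h / (q - 1); 0, 1] : Matrix (Fin 2) (Fin 2) ℂ)⁻¹
        ⊗ₖ (!![x, h / (q - 1); 0, 1] : Matrix (Fin 2) (Fin 2) ℂ)⁻¹)
      * ofM4 !![1, h, -q * h, h ^ 2;
                0, q, 1 - q ^ 2, q * h;
                0, 0, q, -h;
                0, 0, 0, 1]
      * ((!![x, h / (q - 1); 0, 1] : Matrix (Fin 2) (Fin 2) ℂ)
          ⊗ₖ !![x, h / (q - 1); 0, 1])
      = ofM4 !![1, 0, 0, 0;
                0, q, 1 - q ^ 2, 0;
                0, 0, q, 0;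
                0, 0, 0, 1] := by
  obtain ⟨y, hy⟩ : ∃ y, y = h / (q - 1) := ⟨_, rfl⟩
  obtain rfl : h = y * (q - 1) := by
    rw [hy, div_mul_cancel₀ _ (sub_ne_zero.mpr hq)]
  rw [← hy]
  have hM : IsUnit (!![x, y; 0, 1] : Matrix (Fin 2) (Fin 2) ℂ).det := by
    simpa [Matrix.det_fin_two] using hx
  rw [Matrix.mul_assoc, kronecker_intertwines_BHP, ← Matrix.mul_assoc,
    ← Matrix.mul_kronecker_mul, Matrix.nonsing_inv_mul _ hM, Matrix.one_kronecker_one,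
    Matrix.one_mul]
end

section
/- Let A be a unital associative ℂ-algebra, a ∈ ℂ with a ≠ 0, q = exp(a) with q² ≠ 1, and a₊ ∈ ℂ. Let J₀, J₊, J₋ ∈ A and let K ∈ A be invertible, satisfying: J₀K = KJ₀, [J₀,J₊] = 2J₊, [J₀,J₋] = −2J₋, KJ₊K⁻¹ = q·J₊, KJ₋K⁻¹ = q⁻¹·J₋, and [J₊,J₋] = (K² − K⁻²)/(q − q⁻¹). Define J'₋ = ((q−q⁻¹)/(2a))·J₋ − (a₊/(2a²))·(K − K⁻¹) − (a₊²/(4a²))·J₊. Then: (i) [J₀, J'₋] = −2J'₋ − (a₊/a²)·(K − K⁻¹) − (a₊²/a²)·J₊; and (ii) [J₊, J'₋] = (K² − K⁻²)/(2a) + (a₊(q−1)/(2a²))·(K⁻¹J₊ + J₊K). These are the Ballesteros–Herranz–Parashar (q,h)-deformed commutation relations, obtained from Uq(sl(2)) by an invertible change of generators. -/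
/-- The Ballesteros–Herranz–Parashar `(q,h)`-deformed commutation relations are
obtained from `U_q(sl(2))` by the invertible change of generators
`J'₋ = ((q−q⁻¹)/(2a))·J₋ − (a₊/(2a²))·(K − K⁻¹) − (a₊²/(4a²))·J₊`.
Here `J0, Jp, Jm` stand for `J₀, J₊, J₋`, `ap` for `a₊`, `K` for `q^{J₀/2}`
(with inverse `Kinv`), and `J'm` for the new generator `J'₋`. -/
theorem BHP_map_from_Uq_sl2 (A : Type*) [Ring A] [Algebra ℂ A]
    (a ap q : ℂ) (ha : a ≠ 0) (hq : q = Complex.exp a) (hq2 : q ^ 2 ≠ 1)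
    (J0 Jp Jm K Kinv J'm : A)
    (hK : K * Kinv = 1) (hK' : Kinv * K = 1)
    (c1 : J0 * K = K * J0)
    (c2 : J0 * Jp - Jp * J0 = (2 : ℂ) • Jp)
    (c3 : J0 * Jm - Jm * J0 = (-2 : ℂ) • Jm)
    (c4 : K * Jp * Kinv = q • Jp)
    (c5 : K * Jm * Kinv = q⁻¹ • Jm)
    (c6 : Jp * Jm - Jm * Jp = (q - q⁻¹)⁻¹ • (K * K - Kinv * Kinv))
    (hdef : J'm = ((q - q⁻¹) / (2 * a)) • Jm - (ap / (2 * a ^ 2)) • (K - Kinv)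
        - (ap ^ 2 / (4 * a ^ 2)) • Jp) :
    J0 * J'm - J'm * J0
        = (-2 : ℂ) • J'm - (ap / a ^ 2) • (K - Kinv) - (ap ^ 2 / a ^ 2) • Jp ∧
      Jp * J'm - J'm * Jp
        = (2 * a)⁻¹ • (K * K - Kinv * Kinv)
            + (ap * (q - 1) / (2 * a ^ 2)) • (Kinv * Jp + Jp * K) := by
  have hq0 : q ≠ 0 := hq ▸ Complex.exp_ne_zero a
  have hqq : q - q⁻¹ ≠ 0 := by
    intro h
    apply hq2
    rw [sub_eq_zero] at h
    rw [pow_two]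
    nth_rewrite 2 [h]
    exact mul_inv_cancel₀ hq0
  have hKJp : K * Jp = q • (Jp * K) := by
    calc K * Jp = K * Jp * Kinv * K := by rw [mul_assoc _ Kinv, hK', mul_one]
      _ = q • (Jp * K) := by rw [c4, smul_mul_assoc]
  have hJpKinv : Jp * Kinv = q • (Kinv * Jp) := by
    calc Jp * Kinv = Kinv * (K * Jp * Kinv) := by
          rw [mul_assoc K, ← mul_assoc, hK', one_mul]
      _ = q • (Kinv * Jp) := by rw [c4, mul_smul_comm]
  have hJ0Kinv : J0 * Kinv = Kinv * J0 := by
    calc J0 * Kinv = Kinv * (K * J0) * Kinv := by rw [← mul_assoc, hK', one_mul]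
      _ = Kinv * J0 := by rw [← c1, mul_assoc, mul_assoc, hK, mul_one]
  rw [sub_eq_iff_eq_add] at c2 c3 c6
  constructor
  · simp only [hdef, mul_sub, sub_mul, mul_smul_comm, smul_mul_assoc, c1, c2, c3, hJ0Kinv]
    match_scalars <;> field_simp <;> ring
  · simp only [hdef, mul_sub, sub_mul, mul_smul_comm, smul_mul_assoc, c6, hKJp, hJpKinv,
      smul_add, smul_smul, div_mul_eq_mul_div, mul_inv_cancel₀ hqq, one_div]
    module
end

section
/- Let λ,η₀ ∈ ℂ with λ ≠ 0. For s ∈ ℂ, s ≠ 0, set p(s) = 1 + s, q(s) = 1 + λ²s, η(s) = η₀/(λs), G(s) = [[1,η(s)],[0,1]], and F(s) = (G(s)⁻¹⊗G(s)⁻¹)·R_{p(s),q(s)}·(G(s)⊗G(s)), where R_{p,q} = [[p,0,0,0],[0,pq,p−q,0],[0,0,1,0],[0,0,0,p]]. Set h = λη₀ and g = −λ⁻¹η₀. Then F(s) converges, as s → 0 with s ≠ 0, to the two-parametric nonstandard (Jordanian) R-matrix R_{g,h} = [[1,−h,h,gh],[0,1,0,−g],[0,0,1,g],[0,0,0,1]].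 -/
open Matrix
open scoped Kronecker

/-- For `s ≠ 0` the conjugated `R`-matrix is a matrix of polynomials in `s`. -/
theorem conj_R_eq (lam η₀ s : ℂ) (hlam : lam ≠ 0) (hs : s ≠ 0) :
    ((!![1, η₀ / (lam * s); 0, 1] : Matrix (Fin 2) (Fin 2) ℂ)⁻¹
        ⊗ₖ (!![1, η₀ / (lam * s); 0, 1] : Matrix (Fin 2) (Fin 2) ℂ)⁻¹)
      * ofM4 !![1 + s, 0, 0, 0;
                0, (1 + s) * (1 + lam ^ 2 * s), (1 + s) - (1 + lam ^ 2 * s), 0;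
                0, 0, 1, 0;
                0, 0, 0, 1 + s]
      * ((!![1, η₀ / (lam * s); 0, 1] : Matrix (Fin 2) (Fin 2) ℂ)
          ⊗ₖ !![1, η₀ / (lam * s); 0, 1]) =
    ofM4 !![1 + s, -((1 + s) * (lam * η₀)), lam * η₀, -η₀ ^ 2;
            0, (1 + s) * (1 + lam ^ 2 * s), (1 + s) - (1 + lam ^ 2 * s),
              lam⁻¹ * η₀ * (1 + lam ^ 2 * s);
            0, 0, 1, -(lam⁻¹ * η₀);
            0, 0, 0, 1 + s] := by
  have hinv : (!![1, η₀ / (lam * s); 0, 1] : Matrix (Fin 2) (Fin 2) ℂ)⁻¹ =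
      !![1, -(η₀ / (lam * s)); 0, 1] := by
    simp [Matrix.inv_def, Matrix.det_fin_two, Matrix.adjugate_fin_two]
  rw [hinv]
  ext ⟨i, j⟩ ⟨k, l⟩
  fin_cases i <;> fin_cases j <;> fin_cases k <;> fin_cases l <;>
    simp [Matrix.mul_apply, Fintype.sum_prod_type, Fin.sum_univ_two, ofM4, idx] <;>
    field_simp <;> ring

/-- In the singular limit `s → 0` (so `p = 1 + s → 1`, `q = 1 + λ²s → 1` with
`((q−1)/(p−1))^{1/2} = λ` fixed and `η = η₀/(λs)`), the transformed standard
biparametric `R_{p,q}` tends to the two-parametric nonstandard (Jordanian)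
`R_{g,h}` with `h = λη₀`, `g = −λ⁻¹η₀`. -/
theorem singular_limit_to_Jordanian (lam η₀ g h : ℂ) (hlam : lam ≠ 0)
    (hh : h = lam * η₀) (hg : g = -(lam⁻¹ * η₀)) :
    Filter.Tendsto
      (fun s : ℂ =>
        ((!![1, η₀ / (lam * s); 0, 1] : Matrix (Fin 2) (Fin 2) ℂ)⁻¹
            ⊗ₖ (!![1, η₀ / (lam * s); 0, 1] : Matrix (Fin 2) (Fin 2) ℂ)⁻¹)
          * ofM4 !![1 + s, 0, 0, 0;
                    0, (1 + s) * (1 + lam ^ 2 * s), (1 + s) - (1 + lam ^ 2 * s), 0;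
                    0, 0, 1, 0;
                    0, 0, 0, 1 + s]
          * ((!![1, η₀ / (lam * s); 0, 1] : Matrix (Fin 2) (Fin 2) ℂ)
              ⊗ₖ !![1, η₀ / (lam * s); 0, 1]))
      (nhdsWithin 0 {0}ᶜ)
      (nhds (ofM4 !![1, -h, h, g * h;
                     0, 1, 0, -g;
                     0, 0, 1, g;
                     0, 0, 0, 1])) := by
  subst hh hg
  refine Filter.Tendsto.congr' (Filter.eventually_of_mem self_mem_nhdsWithin
    fun s hs => (conj_R_eq lam η₀ s hlam hs).symm) ?_
  have hlim : ofM4 !![1, -(lam * η₀), lam * η₀, -(lam⁻¹ * η₀) * (lam * η₀);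
        0, 1, 0, -(-(lam⁻¹ * η₀));
        0, 0, 1, -(lam⁻¹ * η₀);
        0, 0, 0, 1] =
      (fun s : ℂ => ofM4 !![1 + s, -((1 + s) * (lam * η₀)), lam * η₀, -η₀ ^ 2;
        0, (1 + s) * (1 + lam ^ 2 * s), (1 + s) - (1 + lam ^ 2 * s),
          lam⁻¹ * η₀ * (1 + lam ^ 2 * s);
        0, 0, 1, -(lam⁻¹ * η₀);
        0, 0, 0, 1 + s]) 0 := by
    have hcorner : -(lam⁻¹ * η₀) * (lam * η₀) = -η₀ ^ 2 := by field_simp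
    simp only [hcorner]
    simp
  rw [hlim]
  refine (Continuous.tendsto ?_ 0).mono_left nhdsWithin_le_nhds
  refine continuous_matrix fun ⟨i, j⟩ ⟨k, l⟩ => ?_
  fin_cases i <;> fin_cases j <;> fin_cases k <;> fin_cases l <;>
    simp [ofM4, idx] <;> fun_prop
end

section
/- For all g,h ∈ ℂ, the two-parametric nonstandard (Jordanian) R-matrix R_{g,h} = [[1,−h,h,gh],[0,1,0,−g],[0,0,1,g],[0,0,0,1]] satisfies the quantum Yang–Baxter equation R₁₂R₁₃R₂₃ = R₂₃R₁₃R₁₂. -/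
open Matrix
open scoped Kronecker

/-- The two-parametric nonstandard (Jordanian) `R_{g,h}` satisfies the quantum
Yang–Baxter equation. -/
theorem Jordanian_YangBaxter (g h : ℂ) :
    R12 (ofM4 !![1, -h, h, g * h;
                 0, 1, 0, -g;
                 0, 0, 1, g;
                 0, 0, 0, 1])
        * R13 (ofM4 !![1, -h, h, g * h;
                       0, 1, 0, -g;
                       0, 0, 1, g;
                       0, 0, 0, 1])
        * R23 (ofM4 !![1, -h, h, g * h;
                       0, 1, 0, -g;
                       0, 0, 1, g;
                       0, 0, 0, 1])
      = R23 (ofM4 !![1, -h, h, g * h;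
                     0, 1, 0, -g;
                     0, 0, 1, g;
                     0, 0, 0, 1])
          * R13 (ofM4 !![1, -h, h, g * h;
                         0, 1, 0, -g;
                         0, 0, 1, g;
                         0, 0, 0, 1])
          * R12 (ofM4 !![1, -h, h, g * h;
                         0, 1, 0, -g;
                         0, 0, 1, g;
                         0, 0, 0, 1]) := by
  ext ⟨i, j, k⟩ ⟨i', j', k'⟩
  simp only [Matrix.mul_apply, Fintype.sum_prod_type, Fin.sum_univ_two, R12, R13, R23, ofM4, idx,
    Matrix.of_apply]
  fin_cases i <;> fin_cases j <;> fin_cases k <;> fin_cases i' <;> fin_cases j' <;>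
    fin_cases k' <;> simp <;> ring
end

section
/- Let x₁,x₂,x₃ ∈ ℂ with x₁ + x₂ ≠ 0, and let R = [[1,x₁,x₂,x₃],[0,1,0,x₂],[0,0,1,x₁],[0,0,0,1]] (the Hietarinta R_{H2,3} matrix with k = 1). Let A be a unital associative ℂ-algebra and suppose a,b,c,d ∈ A are such that R satisfies the RTT relation with T = [[a,b],[c,d]]. Then: c² = 0, ca = 0, ac = 0, dc = 0, cd = 0, da = ad, cb = bc, a² = d², a² = ad + bc, ab = bd, ab = ba + (x₁−x₂)·bc, db = bd + (x₂−x₁)·bc, and moreover a³ = a²d. -/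
open Matrix
open scoped Kronecker

/-- The RTT relations for the Hietarinta `R_{H2,3}` matrix (`k = 1`) with
`x₁ + x₂ ≠ 0` force a rather degenerate algebra. -/
theorem H23_RTT_relations (x₁ x₂ x₃ : ℂ) (hx : x₁ + x₂ ≠ 0)
    (A : Type*) [Ring A] [Algebra ℂ A] (a b c d : A)
    (hRTT : RTT (ofM4 !![1, x₁, x₂, x₃;
                         0, 1, 0, x₂;
                         0, 0, 1, x₁;
                         0, 0, 0, 1]) !![a, b; c, d]) :
    c ^ 2 = 0 ∧ c * a = 0 ∧ a * c = 0 ∧ d * c = 0 ∧ c * d = 0 ∧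
      d * a = a * d ∧ c * b = b * c ∧ a ^ 2 = d ^ 2 ∧ a ^ 2 = a * d + b * c ∧
      a * b = b * d ∧ a * b = b * a + (x₁ - x₂) • (b * c) ∧
      d * b = b * d + (x₂ - x₁) • (b * c) ∧ a ^ 3 = a ^ 2 * d := by
  have cancel : ∀ {u : A}, (x₁ + x₂) • u = 0 → u = 0 := fun h =>
    (smul_eq_zero_iff_right hx).mp h
  have h := Matrix.ext_iff.mpr hRTT
  simp [ofM4, idx, Matrix.mul_apply, Fintype.sum_prod_type, Prod.forall, Fin.forall_fin_two,
    ← Algebra.commutes, add_mul, mul_assoc] at h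
  simp only [← Algebra.smul_def] at h
  obtain ⟨⟨⟨⟨e1111, e1112⟩, e1121, e1122⟩, ⟨e1211, e1212⟩, e1221, e1222⟩,
    ⟨⟨e2111, e2112⟩, -, e2122⟩, e2212, -, -⟩ := h
  have cc : c * c = 0 := cancel (by linear_combination (norm := module) e1211 + e2111)
  have ac_comm : c * a = a * c := by simpa [cc] using e2111
  have ac : a * c = 0 := by
    simp only [ac_comm, cc, smul_zero] at e1111
    exact cancel (by linear_combination (norm := module) e1111)
  have ca : c * a = 0 := ac_comm.trans ac
  have cd_comm : c * d = d * c := by simpa [cc] using e2212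
  simp only [ca, ac, smul_zero, zero_add, ← cd_comm] at e1212 e2112 e1221 e1222 e2122
  have cd : c * d = 0 := cancel (by linear_combination (norm := module) e2112 + e1221)
  have dc : d * c = 0 := cd_comm.symm.trans cd
  have da : d * a = a * d := by simpa [cd] using e1212.symm
  have cb : c * b = b * c := by simpa [cd] using e2112
  simp only [da, cb, cd, dc, smul_zero, add_zero] at e1112 e1121 e1222 e2122 e1122
  have aa : a * a = a * d + b * c :=
    sub_eq_zero.mp (cancel (by linear_combination (norm := module) -e1112 - e1121))
  have dd : d * d = a * d + b * c :=
    sub_eq_zero.mp (cancel (by linear_combination (norm := module) e1222 + e2122))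
  have ab_ba : a * b = b * a + (x₁ - x₂) • (b * c) := by
    linear_combination (norm := module) e1112 + x₁ • aa
  have db_bd : d * b = b * d + (x₂ - x₁) • (b * c) := by
    linear_combination (norm := module) e2122 - x₁ • dd
  have ab : a * b = b * d := sub_eq_zero.mp (cancel (by
    linear_combination (norm := module) -e1122 + x₃ • dd - x₃ • aa + x₂ • db_bd + x₂ • ab_ba))
  have abc : a * (b * c) = 0 := by rw [← mul_assoc, ab, mul_assoc, dc, mul_zero]
  refine ⟨by rw [sq, cc], ca, ac, dc, cd, da, cb, by rw [sq, sq, aa, dd], by rw [sq, aa],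
    ab, ab_ba, db_bd, ?_⟩
  calc a ^ 3 = a * (a * a) := by rw [pow_succ', sq]
    _ = a ^ 2 * d := by rw [aa, mul_add, abc, add_zero, sq, mul_assoc]
end

section
/- Let h,x₃ ∈ ℂ with x₃ ≠ −h², and let R = [[1,h,−h,x₃],[0,1,0,−h],[0,0,1,h],[0,0,0,1]] (the Hietarinta R_{H2,3} matrix with k = 1, x₁ = h, x₂ = −h). Let A be a unital associative ℂ-algebra and suppose a,b,c,d ∈ A are such that R satisfies the RTT relation with T = [[a,b],[c,d]]. Then: c² = 0, ca = 0, ac = 0, dc = 0, cd = 0, da = ad, cb = bc, a² = d², ab = ba + h·(a² + bc − ad), and db = bd − h·(a² + bc − ad). -/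
open Matrix
open scoped Kronecker

theorem eq_zero_of_add_sq_smul_eq_zero {A : Type*} [AddCommGroup A] [Module ℂ A]
    {h x : ℂ} (hx : x ≠ -h ^ 2) {y : A} (hy : (x + h ^ 2) • y = 0) : y = 0 :=
  (smul_eq_zero.mp hy).resolve_left fun hz => hx (by linear_combination hz)

/-- The RTT relations for the Hietarinta `R_{H2,3}` matrix with `k = 1`,
`x₁ = h`, `x₂ = −h`, `x₃ ≠ −h²`. -/
theorem H23_RTT_relations_case2 (h x₃ : ℂ) (hx : x₃ ≠ -h ^ 2)
    (A : Type*) [Ring A] [Algebra ℂ A] (a b c d : A)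
    (hRTT : RTT (ofM4 !![1, h, -h, x₃;
                         0, 1, 0, -h;
                         0, 0, 1, h;
                         0, 0, 0, 1]) !![a, b; c, d]) :
    c ^ 2 = 0 ∧ c * a = 0 ∧ a * c = 0 ∧ d * c = 0 ∧ c * d = 0 ∧
      d * a = a * d ∧ c * b = b * c ∧ a ^ 2 = d ^ 2 ∧
      a * b = b * a + h • (a ^ 2 + b * c - a * d) ∧
      d * b = b * d - h • (a ^ 2 + b * c - a * d) := by
  have entry := fun p q => congrFun (congrFun hRTT p) q
  simp only [ofM4, idx, Matrix.mul_apply, Fintype.sum_prod_type, Fin.sum_univ_two,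
    Matrix.kroneckerMap_apply, Matrix.map_apply, Matrix.of_apply] at entry
  have e12 := entry (0, 0) (0, 1)
  have e13 := entry (0, 0) (1, 0)
  have e14 := entry (0, 0) (1, 1)
  have e21 := entry (0, 1) (0, 0)
  have e22 := entry (0, 1) (0, 1)
  have e23 := entry (0, 1) (1, 0)
  have e24 := entry (0, 1) (1, 1)
  have e34 := entry (1, 0) (1, 1)
  have e42 := entry (1, 1) (0, 1)
  have e44 := entry (1, 1) (1, 1)
  clear entry hRTT
  simp [Algebra.algebraMap_eq_smul_one, add_mul] at e12 e13 e14 e21 e22 e23 e24 e34 e42 e44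
  have hcc : c * c = 0 := by
    apply eq_zero_of_add_sq_smul_eq_zero hx
    linear_combination (norm := module) (-1 : ℂ) • e44 - h • e42
  simp only [hcc, smul_zero, neg_zero, zero_add, add_zero] at e21 e42
  have hcd : c * d = 0 := by
    apply eq_zero_of_add_sq_smul_eq_zero hx
    linear_combination (norm := module)
      (1 / 2 : ℂ) • (e12 + e13 - h • e22 - h • e23) + ((x₃ + h ^ 2) / 2) • e42
  have hdc : d * c = 0 := e42.symm.trans hcd
  simp only [hcd, hdc, smul_zero, neg_zero, add_zero] at e12 e13 e22 e23 e21
  have hca : c * a = 0 := by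
    apply eq_zero_of_add_sq_smul_eq_zero hx
    linear_combination (norm := module)
      (-1 / 2 : ℂ) • (e24 + e34 + h • e22 - h • e23) - (x₃ / 2) • e21
  have hac : a * c = 0 := e21.trans hca
  simp only [hca, hac, smul_zero, neg_zero, zero_add] at e22 e23 e24 e34
  have haa : d * d - a * a = 0 := by
    apply eq_zero_of_add_sq_smul_eq_zero hx
    linear_combination (norm := module) e14 - h • e24 + h • e12 - h ^ 2 • e22
  simp only [pow_two]
  refine ⟨hcc, hca, hac, hdc, hcd, e22.symm, e23.symm, (sub_eq_zero.mp haa).symm, ?_, ?_⟩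
  · linear_combination (norm := module) (-1 : ℂ) • e13 + h • e22
  · linear_combination (norm := module) e34 - h • haa
end

section
/- Let R = [[1,0,0,1],[0,−1,0,0],[0,0,−1,0],[0,0,0,1]] (the Hietarinta R_{S0,2} matrix). Let A be a unital associative ℂ-algebra and suppose a,b,c,d ∈ A are such that R satisfies the RTT relation with T = [[a,b],[c,d]]. Then: c² = 0, ca = 0, ac = 0, dc = 0, cd = 0, da = ad, cb = bc, a² = d², ab + ba = 0, and db + bd = 0. -/
open Matrix
open scoped Kronecker

theorem eq_zero_of_add_self_eq_zero {A : Type*} [Ring A] [Algebra ℂ A] {x : A}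
    (h : x + x = 0) : x = 0 := by
  rw [← two_smul ℂ x] at h
  exact (smul_eq_zero_iff_right two_ne_zero).mp h

/-- The RTT relations for the Hietarinta `R_{S0,2}` matrix give a degenerate
superalgebra. -/
theorem S02_RTT_relations (A : Type*) [Ring A] [Algebra ℂ A] (a b c d : A)
    (hRTT : RTT (ofM4 !![1, 0, 0, 1;
                         0, -1, 0, 0;
                         0, 0, -1, 0;
                         0, 0, 0, 1]) !![a, b; c, d]) :
    c ^ 2 = 0 ∧ c * a = 0 ∧ a * c = 0 ∧ d * c = 0 ∧ c * d = 0 ∧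
      d * a = a * d ∧ c * b = b * c ∧ a ^ 2 = d ^ 2 ∧
      a * b + b * a = 0 ∧ d * b + b * d = 0 := by
  have entry (p q : Idx) := congrFun (congrFun hRTT p) q
  have h₁ := entry (0, 0) (0, 0)
  have h₂ := entry (0, 0) (0, 1)
  have h₃ := entry (0, 0) (1, 0)
  have h₄ := entry (0, 0) (1, 1)
  have h₅ := entry (0, 1) (0, 0)
  have h₆ := entry (0, 1) (0, 1)
  have h₇ := entry (0, 1) (1, 0)
  have h₈ := entry (0, 1) (1, 1)
  have h₉ := entry (1, 0) (1, 1)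
  have h₁₀ := entry (1, 1) (0, 1)
  simp [ofM4, idx, Matrix.mul_apply, Fintype.sum_prod_type, Fin.sum_univ_two,
    Matrix.one_apply] at h₁ h₂ h₃ h₄ h₅ h₆ h₇ h₈ h₉ h₁₀
  have hcd : c * d = 0 := eq_zero_of_add_self_eq_zero (by
    linear_combination (norm := abel) h₂ - h₃ + h₁₀)
  have hca : c * a = 0 := eq_zero_of_add_self_eq_zero (by
    linear_combination (norm := abel) h₉ - h₈ - h₅)
  rw [pow_two, pow_two, pow_two]
  refine ⟨h₁, hca, ?_, ?_, hcd, h₆.symm, h₇.symm, ?_, ?_, ?_⟩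
  · linear_combination (norm := abel) -h₅ - hca
  · linear_combination (norm := abel) h₁₀ - hcd
  · linear_combination (norm := abel) -h₄
  · linear_combination (norm := abel) h₂ - hcd
  · linear_combination (norm := abel) -h₈ - hca
end

section
/- Let q,h ∈ ℂ with q ≠ 0 and q ≠ −1, and let R_{q,h} = [[1,0,0,h],[0,1,1−q,0],[0,0,q,0],[0,0,0,−q]] be the hybrid R-matrix of GL_{q,h}(1|1). Let A be a unital associative ℂ-algebra and suppose a,b,c,d ∈ A are such that R_{q,h} satisfies the RTT relation with T = [[a,b],[c,d]]. Then the GL_{q,h}(1|1) relations hold: ba = ab + h·cd, ca = q⁻¹·ac, da = ad − (1 − q⁻¹)·bc, cb = q⁻¹·bc, db = −bd + h·q⁻¹·ac, dc = −q·cd, c² = 0, and h·a² = (q+1)·b² + h·d². -/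
open Matrix
open scoped Kronecker

/-- The RTT relations for the hybrid `R_{q,h}` of `GL_{q,h}(1|1)` give the
`GL_{q,h}(1|1)` relations. -/
theorem GLqh11_RTT_relations (q h : ℂ) (hq0 : q ≠ 0) (hq1 : q ≠ -1)
    (A : Type*) [Ring A] [Algebra ℂ A] (a b c d : A)
    (hRTT : RTT (ofM4 !![1, 0, 0, h;
                         0, 1, 1 - q, 0;
                         0, 0, q, 0;
                         0, 0, 0, -q]) !![a, b; c, d]) :
    b * a = a * b + h • (c * d) ∧
      c * a = q⁻¹ • (a * c) ∧
      d * a = a * d - (1 - q⁻¹) • (b * c) ∧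
      c * b = q⁻¹ • (b * c) ∧
      d * b = -(b * d) + (h * q⁻¹) • (a * c) ∧
      d * c = -(q • (c * d)) ∧
      c ^ 2 = 0 ∧
      h • (a ^ 2) = (q + 1) • (b ^ 2) + h • (d ^ 2) := by
  have entry := fun i j k l => congrFun (congrFun hRTT (i, j)) (k, l)
  have hba := entry 0 0 0 1
  have haa := entry 0 0 1 1
  have hca := entry 1 0 0 0
  have hcb := entry 1 0 0 1
  have hda := entry 1 0 1 0
  have hdb := entry 1 0 1 1
  have hcc := entry 1 1 0 0
  have hdc := entry 1 1 0 1
  clear entry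
  simp [Matrix.mul_apply, Fintype.sum_prod_type, Fin.sum_univ_two, ofM4, idx,
    Matrix.one_apply, ← Algebra.commutes, ← Algebra.smul_def]
    at hba haa hca hcb hda hdb hcc hdc
  have hq1' : q + 1 ≠ 0 := fun h0 => hq1 (eq_neg_of_add_eq_zero_left h0)
  refine ⟨hba.symm, ?_, ?_, ?_, ?_, hdc.symm, ?_, ?_⟩
  · rw [← hca, inv_smul_smul₀ hq0]
  · rw [← inv_smul_smul₀ hq0 (d * a), hda]
    match_scalars <;> field_simp
    ring
  · rw [← hcb, inv_smul_smul₀ hq0]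
  · rw [← inv_smul_smul₀ hq0 (d * b), hdb]
    match_scalars <;> field_simp
  · have hcc' : (q + 1) • (c * c) = 0 := by
      rw [add_smul, one_smul]
      nth_rewrite 2 [← hcc]
      exact add_neg_cancel _
    rw [pow_two]
    exact (smul_eq_zero_iff_right hq1').mp hcc'
  · simp only [pow_two, add_smul, one_smul]
    rw [add_assoc, haa]
    abel
end

section
/- Let q,h,x,y ∈ ℂ with x ≠ 0, let M = [[x,y],[0,x⁻¹]], and let R_{q,h} = [[1,0,0,h],[0,1,1−q,0],[0,0,q,0],[0,0,0,−q]]. Then (M⊗M)·R_{q,h}·(M⁻¹⊗M⁻¹) = [[1,0,0, h·x⁴ − (1+q)·(xy)²],[0,1,1−q,−2xy],[0,0,q,−2qxy],[0,0,0,−q]]. Consequently, if h ≠ 0 then for no choice of x ≠ 0 and y does (M⊗M)·R_{q,h}·(M⁻¹⊗M⁻¹) equal R_{q,0} = [[1,0,0,0],[0,1,1−q,0],[0,0,q,0],[0,0,0,−q]]; the parameter h cannot be transformed away, so the (q,h)-deformation of GL(1|1) is an authentic hybrid deformation. -/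
open Matrix
open scoped Kronecker

lemma inv_upperTriangular {x : ℂ} (y : ℂ) (hx : x ≠ 0) :
    (!![x, y; 0, x⁻¹] : Matrix (Fin 2) (Fin 2) ℂ)⁻¹ = !![x⁻¹, -y; 0, x] := by
  apply Matrix.inv_eq_right_inv
  ext i j
  fin_cases i <;> fin_cases j <;> simp [Matrix.mul_apply, hx] <;> ring

lemma kronecker_conj_hybrid (q h : ℂ) {x : ℂ} (y : ℂ) (hx : x ≠ 0) :
    ((!![x, y; 0, x⁻¹] : Matrix (Fin 2) (Fin 2) ℂ) ⊗ₖ !![x, y; 0, x⁻¹])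
        * ofM4 !![1, 0, 0, h;
                  0, 1, 1 - q, 0;
                  0, 0, q, 0;
                  0, 0, 0, -q]
        * ((!![x, y; 0, x⁻¹] : Matrix (Fin 2) (Fin 2) ℂ)⁻¹
            ⊗ₖ (!![x, y; 0, x⁻¹] : Matrix (Fin 2) (Fin 2) ℂ)⁻¹)
      = ofM4 !![1, 0, 0, h * x ^ 4 - (1 + q) * (x * y) ^ 2;
                0, 1, 1 - q, -2 * x * y;
                0, 0, q, -2 * q * x * y;
                0, 0, 0, -q] := by
  rw [inv_upperTriangular y hx]
  ext ⟨i, j⟩ ⟨k, l⟩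
  fin_cases i <;> fin_cases j <;> fin_cases k <;> fin_cases l <;>
    simp [Matrix.mul_apply, Fintype.sum_prod_type, ofM4, idx] <;>
    field_simp <;> ring

/-- The similarity transform of the hybrid `R_{q,h}` of `GL_{q,h}(1|1)` by
`M ⊗ M`, `M = [[x,y],[0,x⁻¹]]`; for `h ≠ 0` no choice of `x ≠ 0` and `y` can
transform `h` away, so the `(q,h)`-deformation of `GL(1|1)` is an authentic
hybrid deformation. -/
theorem GLqh11_authentic_hybrid (q h x y : ℂ) (hx : x ≠ 0) :
    ((!![x, y; 0, x⁻¹] : Matrix (Fin 2) (Fin 2) ℂ) ⊗ₖ !![x, y; 0, x⁻¹])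
        * ofM4 !![1, 0, 0, h;
                  0, 1, 1 - q, 0;
                  0, 0, q, 0;
                  0, 0, 0, -q]
        * ((!![x, y; 0, x⁻¹] : Matrix (Fin 2) (Fin 2) ℂ)⁻¹
            ⊗ₖ (!![x, y; 0, x⁻¹] : Matrix (Fin 2) (Fin 2) ℂ)⁻¹)
      = ofM4 !![1, 0, 0, h * x ^ 4 - (1 + q) * (x * y) ^ 2;
                0, 1, 1 - q, -2 * x * y;
                0, 0, q, -2 * q * x * y;
                0, 0, 0, -q] ∧
    (h ≠ 0 → ∀ x' y' : ℂ, x' ≠ 0 →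
      ((!![x', y'; 0, x'⁻¹] : Matrix (Fin 2) (Fin 2) ℂ) ⊗ₖ !![x', y'; 0, x'⁻¹])
          * ofM4 !![1, 0, 0, h;
                    0, 1, 1 - q, 0;
                    0, 0, q, 0;
                    0, 0, 0, -q]
          * ((!![x', y'; 0, x'⁻¹] : Matrix (Fin 2) (Fin 2) ℂ)⁻¹
              ⊗ₖ (!![x', y'; 0, x'⁻¹] : Matrix (Fin 2) (Fin 2) ℂ)⁻¹)
        ≠ ofM4 !![1, 0, 0, 0;
                  0, 1, 1 - q, 0;
                  0, 0, q, 0;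
                  0, 0, 0, -q]) := by
  refine ⟨kronecker_conj_hybrid q h y hx, fun hh x' y' hx' heq => ?_⟩
  rw [kronecker_conj_hybrid q h y' hx'] at heq
  have hxy := congrFun (congrFun heq (0, 1)) (1, 1)
  have hcorner := congrFun (congrFun heq (0, 0)) (1, 1)
  simp [ofM4, idx, hx'] at hxy
  simp [ofM4, idx, hxy, hx', hh] at hcorner
end
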